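/- For each i = 1,…,n, let {x_k^{(i)}}_{k=1}^{n−i+1} be a linearly independent family of n−i+1 vectors in ℝⁿ each of whose coordinates 1,…,i−1 are zero and whose i-th coordinate is nonzero. Then the union over i of these families, consisting of n(n+1)/2 vectors, is a frame for ℝⁿ which is injective. -/

import Mathlib

open scoped InnerProductSpace

def tailSub (n m : ℕ) : Submodule ℝ (EuclideanSpace ℝ (Fin n)) where
  carrier := {v | ∀ j : Fin n, (j : ℕ) < m → v j = 0}
  add_mem' := by
    intro a b ha hb j hj
    simp [ha j hj, hb j hj]
  zero_mem' := by
    intro j hj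
    simp
  smul_mem' := by
    intro c a ha j hj
    simp [ha j hj]

lemma mem_tailSub {n m : ℕ} {v : EuclideanSpace ℝ (Fin n)} :
    v ∈ tailSub n m ↔ ∀ j : Fin n, (j : ℕ) < m → v j = 0 := Iff.rfl

lemma finrank_tailSub (n m : ℕ) : Module.finrank ℝ (tailSub n m) ≤ n - m := by
  let f : tailSub n m →ₗ[ℝ] (Fin (n - m) → ℝ) :=
    { toFun := fun v k => v.1 ⟨m + k, by omega⟩
      map_add' := by intro a b; ext k; simp
      map_smul' := by intro a b; ext k; simp }
  have hf : Function.Injective f := by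
    rw [injective_iff_map_eq_zero]
    intro v hv
    ext j
    by_cases h : (j : ℕ) < m
    · simpa using v.2 j h
    · have := congrFun hv ⟨(j : ℕ) - m, by omega⟩
      have e : (⟨m + ((j : ℕ) - m), by omega⟩ : Fin n) = j := by ext; simp; omega
      simp only [f, LinearMap.coe_mk, AddHom.coe_mk, Pi.zero_apply] at this
      rw [e] at this
      simpa using this
  simpa using LinearMap.finrank_le_finrank_of_injective hf

lemma inj_aux {n : ℕ} (x : (i : Fin n) → Fin (n - (i : ℕ)) → EuclideanSpace ℝ (Fin n))
    (hzero : ∀ i k (j : Fin n), j < i → x i k j = 0)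
    (hnonzero : ∀ i k, x i k i ≠ 0)
    (hli : ∀ i, LinearIndependent ℝ (x i))
    (T : EuclideanSpace ℝ (Fin n) →L[ℝ] EuclideanSpace ℝ (Fin n))
    (hT : IsSelfAdjoint T)
    (h : ∀ p : (i : Fin n) × Fin (n - (i : ℕ)), ⟪T (x p.1 p.2), x p.1 p.2⟫_ℝ = 0) : T = 0 := by
  have hsym : ∀ v w, ⟪T v, w⟫_ℝ = ⟪T w, v⟫_ℝ := by
    intro v w
    rw [real_inner_comm v (T w)]
    exact hT.isSymmetric v w
  have key : ∀ m, m ≤ n → ∀ v ∈ tailSub n m, ∀ w ∈ tailSub n m, ⟪T v, w⟫_ℝ = 0 := by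
    intro m hm
    induction hm using Nat.decreasingInduction with
    | self =>
      intro v hv w hw
      have : v = 0 := by ext j; simpa using hv j j.2
      simp [this]
    | @of_succ m hm ih =>
      let i : Fin n := ⟨m, hm⟩
      let e : EuclideanSpace ℝ (Fin n) := EuclideanSpace.single i 1
      have hdec : ∀ v ∈ tailSub n m, ∃ v' ∈ tailSub n (m + 1), v = v i • e + v' := by
        intro v hv
        refine ⟨v - v i • e, ?_, by simp⟩
        intro j hj
        by_cases hji : j = i
        · subst hji; simp [e]
        · have : (j : ℕ) ≠ m := fun hh => hji (Fin.ext hh)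
          have := hv j (by omega)
          simp [e, hji, this]
      have hspan : Submodule.span ℝ (Set.range (x i)) = tailSub n m := by
        apply Submodule.eq_of_le_of_finrank_le
        · rw [Submodule.span_le]
          rintro _ ⟨k, rfl⟩ j hj
          exact hzero i k j hj
        · rw [finrank_span_eq_card (hli i), Fintype.card_fin]
          exact finrank_tailSub n m
      let φ : EuclideanSpace ℝ (Fin n) →ₗ[ℝ] ℝ :=
        { toFun := fun v => 2 * ⟪T e, v⟫_ℝ - v i * ⟪T e, e⟫_ℝ
          map_add' := by intro a b; simp [inner_add_right]; ring
          map_smul' := by intro a b; simp [inner_smul_right]; ring }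
      have hφ : ∀ v ∈ tailSub n m, 2 * ⟪T e, v⟫_ℝ - v i * ⟪T e, e⟫_ℝ = 0 := by
        have : tailSub n m ≤ LinearMap.ker φ := by
          rw [← hspan, Submodule.span_le]
          rintro _ ⟨k, rfl⟩
          change 2 * ⟪T e, x i k⟫_ℝ - x i k i * ⟪T e, e⟫_ℝ = 0
          have hx := h ⟨i, k⟩
          obtain ⟨v', hv', hd⟩ := hdec (x i k) (fun j hj => hzero i k j hj)
          have h0 := hnonzero i k
          simp only at hx
          generalize x i k i = c at *
          rw [hd] at hx ⊢
          have h1 := ih v' hv' v' hv'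
          have h2 := hsym v' e
          simp only [map_add, map_smul, inner_add_left, inner_add_right, real_inner_smul_left,
            real_inner_smul_right, h1, h2] at hx ⊢
          apply mul_left_cancel₀ h0
          linear_combination hx
        intro v hv
        exact this hv
      have he : e ∈ tailSub n m := by
        intro j hj
        have : j ≠ i := fun hh => by subst hh; exact lt_irrefl _ hj
        simp [e, this]
      have hee : ⟪T e, e⟫_ℝ = 0 := by
        have := hφ e he
        have h1 : e i = 1 := by simp [e]
        rw [h1] at this
        linarith
      have hev : ∀ v ∈ tailSub n m, ⟪T e, v⟫_ℝ = 0 := by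
        intro v hv
        have := hφ v hv
        rw [hee] at this
        linarith
      intro v hv w hw
      obtain ⟨v', hv', hd⟩ := hdec v hv
      obtain ⟨w', hw', hd'⟩ := hdec w hw
      have hvm : v' ∈ tailSub n m := fun j hj => hv' j (by omega)
      rw [hd, map_add, map_smul, inner_add_left, real_inner_smul_left, hev w hw, hd',
        inner_add_right, real_inner_smul_right, hsym v' e, hev v' hvm, ih v' hv' w' hw']
      simp
  ext1 v
  have := key 0 (Nat.zero_le _) v (fun j hj => absurd hj (by omega)) (T v)
    (fun j hj => absurd hj (by omega))
  simpa using this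

/-- For each `i` (0-based; `i = 1,…,n` in 1-based notation), let
`{x_k^{(i)}}` be a linearly independent family of `n - i` vectors in `ℝⁿ`
whose coordinates `< i` all vanish and whose `i`-th coordinate is nonzero.
Then the combined family of `n(n+1)/2` vectors (indexed by the sigma type)
is a frame for `ℝⁿ` which is injective. -/
theorem stmt_7 {n : ℕ} (x : (i : Fin n) → Fin (n - (i : ℕ)) → EuclideanSpace ℝ (Fin n))
    (hzero : ∀ i k (j : Fin n), j < i → x i k j = 0)
    (hnonzero : ∀ i k, x i k i ≠ 0)
    (hli : ∀ i, LinearIndependent ℝ (x i)) :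
    (∃ A B : ℝ, 0 < A ∧ A ≤ B ∧ ∀ v : EuclideanSpace ℝ (Fin n),
      A * ‖v‖ ^ 2 ≤ ∑ p : (i : Fin n) × Fin (n - (i : ℕ)), ⟪v, x p.1 p.2⟫_ℝ ^ 2 ∧
      ∑ p : (i : Fin n) × Fin (n - (i : ℕ)), ⟪v, x p.1 p.2⟫_ℝ ^ 2 ≤ B * ‖v‖ ^ 2) ∧
    (∀ T : EuclideanSpace ℝ (Fin n) →L[ℝ] EuclideanSpace ℝ (Fin n),
      IsSelfAdjoint T →
      (∀ p : (i : Fin n) × Fin (n - (i : ℕ)), ⟪T (x p.1 p.2), x p.1 p.2⟫_ℝ = 0) → T = 0) := by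
  have hinj := inj_aux x hzero hnonzero hli
  refine ⟨?_, hinj⟩
  let L : EuclideanSpace ℝ (Fin n) →ₗ[ℝ]
      EuclideanSpace ℝ ((i : Fin n) × Fin (n - (i : ℕ))) :=
    { toFun := fun v => WithLp.toLp 2 (fun p => ⟪v, x p.1 p.2⟫_ℝ)
      map_add' := by intro a b; ext p; simp [inner_add_left]
      map_smul' := by intro a b; ext p; simp [real_inner_smul_left] }
  have hL : ∀ v, ‖L v‖ ^ 2 = ∑ p : (i : Fin n) × Fin (n - (i : ℕ)), ⟪v, x p.1 p.2⟫_ℝ ^ 2 := by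
    intro v
    rw [EuclideanSpace.norm_sq_eq]
    simp [L]
  have hker : LinearMap.ker L = ⊥ := by
    rw [LinearMap.ker_eq_bot']
    intro v hv
    have hp : ∀ p : (i : Fin n) × Fin (n - (i : ℕ)), ⟪v, x p.1 p.2⟫_ℝ = 0 := by
      intro p
      have := congrArg (fun u => u p) hv
      simpa [L] using this
    have hT := hinj (InnerProductSpace.rankOne ℝ v v)
      (by
        rw [ContinuousLinearMap.isSelfAdjoint_iff_isSymmetric]
        intro a b
        simp [InnerProductSpace.rankOne_apply, real_inner_smul_left, real_inner_smul_right,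
          real_inner_comm, mul_comm])
      (by
        intro p
        simp [InnerProductSpace.rankOne_apply, real_inner_smul_left, hp p])
    have := congrArg (fun S => S v) hT
    simpa [InnerProductSpace.rankOne_apply] using this
  obtain ⟨K, hK, hanti⟩ := L.exists_antilipschitzWith hker
  have hK' : (0 : ℝ) < K := hK
  have hS : 0 ≤ ∑ p : (i : Fin n) × Fin (n - (i : ℕ)), ‖x p.1 p.2‖ ^ 2 :=
    Finset.sum_nonneg fun _ _ => by positivity
  refine ⟨((K : ℝ) ^ 2)⁻¹, ((K : ℝ) ^ 2)⁻¹ + ∑ p : (i : Fin n) × Fin (n - (i : ℕ)),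
    ‖x p.1 p.2‖ ^ 2, by positivity, by linarith, fun v => ⟨?_, ?_⟩⟩
  · rw [← hL]
    have h1 : ‖v‖ ≤ K * ‖L v‖ := by
      simpa using hanti.le_mul_dist v 0
    rw [inv_mul_le_iff₀ (by positivity), ← mul_pow]
    gcongr
  · have h2 : ∑ p : (i : Fin n) × Fin (n - (i : ℕ)), ⟪v, x p.1 p.2⟫_ℝ ^ 2 ≤
        (∑ p : (i : Fin n) × Fin (n - (i : ℕ)), ‖x p.1 p.2‖ ^ 2) * ‖v‖ ^ 2 := by
      rw [Finset.sum_mul]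
      refine Finset.sum_le_sum fun p _ => ?_
      rw [← mul_pow, mul_comm]
      exact sq_le_sq' (by linarith [neg_le_of_abs_le (abs_real_inner_le_norm v (x p.1 p.2))])
        (real_inner_le_norm _ _)
    have h3 : 0 ≤ ((K : ℝ) ^ 2)⁻¹ * ‖v‖ ^ 2 := by positivity
    rw [add_mul]
    linarith
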